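/- For any finite graphs G and H each with at least one edge, if χ(G) = χ(H) then σ(G) = σ(H). -/

import Mathlib

open SimpleGraph

/-- `o` is an orientation of the simple graph `G`: every oriented pair is an edge of `G`,
and every edge `{x,y}` of `G` receives exactly one of the two directions. -/
def IsOrientation {V : Type*} (G : SimpleGraph V) (o : V → V → Prop) : Prop :=
  (∀ x y, o x y → G.Adj x y) ∧ ∀ x y, G.Adj x y → (o x y ↔ ¬ o y x)

/-- The list of orientations `o 1, …, o k` of `G` is an orientation covering of `G`:
each `o i` is an orientation of `G`, and whenever `xy, xz ∈ E(G)` there is some `i`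
in which both `xy` and `xz` are oriented away from `x`. -/
def IsOrientationCovering {V : Type*} (G : SimpleGraph V) {k : ℕ}
    (o : Fin k → V → V → Prop) : Prop :=
  (∀ i, IsOrientation G (o i)) ∧
    ∀ x y z, G.Adj x y → G.Adj x z → ∃ i, o i x y ∧ o i x z

/-- The orientation covering number `σ(G)`: the smallest positive `k` for which there
exist `k` orientations of `G` forming an orientation covering of `G`. -/
noncomputable def orCov {V : Type*} (G : SimpleGraph V) : ℕ :=
  sInf {k : ℕ | 0 < k ∧ ∃ o : Fin k → V → V → Prop, IsOrientationCovering G o}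

/-- A family `𝒜` of subsets of `[k]` is intersecting if any two of its members meet. -/
def IntersectingFam {k : ℕ} (𝒜 : Finset (Finset (Fin k))) : Prop :=
  ∀ S ∈ 𝒜, ∀ T ∈ 𝒜, (S ∩ T).Nonempty

/-- A family `𝒜` of subsets of `[k]` is maximal intersecting if it is intersecting and is
not properly contained in any intersecting family of subsets of `[k]`. -/
def MaxIntersectingFam {k : ℕ} (𝒜 : Finset (Finset (Fin k))) : Prop :=
  IntersectingFam 𝒜 ∧ ∀ ℬ : Finset (Finset (Fin k)), IntersectingFam ℬ → 𝒜 ⊆ ℬ → ℬ = 𝒜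

/-- `λ(k)`: the number of maximal intersecting families of subsets of `[k]`. -/
noncomputable def lambdaMI (k : ℕ) : ℕ :=
  Nat.card {𝒜 : Finset (Finset (Fin k)) // MaxIntersectingFam 𝒜}

namespace MaxIntersectingFam

variable {k : ℕ} {𝒜 ℬ : Finset (Finset (Fin k))}

/-- A maximal intersecting family contains every set that is nonempty and meets all members. -/
lemma mem_of_forall_inter_nonempty (h𝒜 : MaxIntersectingFam 𝒜) {S : Finset (Fin k)}
    (hS : S.Nonempty) (hmeet : ∀ T ∈ 𝒜, (S ∩ T).Nonempty) : S ∈ 𝒜 := by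
  have hins : IntersectingFam (insert S 𝒜) := by
    intro T hT U hU
    rw [Finset.mem_insert] at hT hU
    rcases hT with rfl | hT <;> rcases hU with rfl | hU
    · simpa using hS
    · exact hmeet U hU
    · rw [Finset.inter_comm]
      exact hmeet T hT
    · exact h𝒜.1 T hT U hU
  rw [← h𝒜.2 _ hins (Finset.subset_insert S 𝒜)]
  exact Finset.mem_insert_self S 𝒜

lemma compl_mem (h𝒜 : MaxIntersectingFam 𝒜) {S : Finset (Fin k)} (hS : S.Nonempty)
    (hS𝒜 : S ∉ 𝒜) : Sᶜ ∈ 𝒜 := by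
  have hT : ∃ T ∈ 𝒜, ¬ (S ∩ T).Nonempty := by
    by_contra! hT
    exact hS𝒜 (h𝒜.mem_of_forall_inter_nonempty hS hT)
  obtain ⟨T, hT, hST⟩ := hT
  have hsub : T ⊆ Sᶜ := fun i hi ↦
    Finset.mem_compl.2 fun hiS ↦ hST ⟨i, Finset.mem_inter.2 ⟨hiS, hi⟩⟩
  have hmeet : ∀ U ∈ 𝒜, (Sᶜ ∩ U).Nonempty := fun U hU ↦
    (h𝒜.1 T hT U hU).mono (Finset.inter_subset_inter_right hsub)
  exact h𝒜.mem_of_forall_inter_nonempty ((hmeet T hT).mono Finset.inter_subset_left) hmeet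

/-- Two distinct maximal intersecting families are separated by a complementary pair. -/
lemma exists_mem_compl_mem (h𝒜 : MaxIntersectingFam 𝒜) (hℬ : MaxIntersectingFam ℬ)
    (hne : 𝒜 ≠ ℬ) : ∃ S ∈ 𝒜, Sᶜ ∈ ℬ := by
  have hS : ∃ S ∈ 𝒜, S ∉ ℬ := by
    by_contra! hS
    exact hne (h𝒜.2 ℬ hℬ.1 hS).symm
  obtain ⟨S, hS, hSℬ⟩ := hS
  exact ⟨S, hS, hℬ.compl_mem (by simpa using h𝒜.1 S hS S hS) hSℬ⟩

end MaxIntersectingFam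

/-- Every intersecting family extends to a maximal one. -/
lemma IntersectingFam.exists_maxIntersectingFam {k : ℕ} {𝒜 : Finset (Finset (Fin k))}
    (h𝒜 : IntersectingFam 𝒜) : ∃ ℬ, 𝒜 ⊆ ℬ ∧ MaxIntersectingFam ℬ := by
  obtain ⟨ℬ, hle, hmax⟩ :=
    (Set.toFinite {𝒞 : Finset (Finset (Fin k)) | IntersectingFam 𝒞}).exists_le_maximal h𝒜
  exact ⟨ℬ, hle, hmax.prop, fun 𝒞 h𝒞 hsub ↦ (hmax.eq_of_le h𝒞 hsub).symm⟩

/-- One can assign to each ordered pair of distinct maximal intersecting families a member of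
the first one, so that swapping the families complements the set. -/
lemma exists_complementary_choice (k : ℕ) :
    ∃ g : {𝒜 : Finset (Finset (Fin k)) // MaxIntersectingFam 𝒜} →
        {𝒜 : Finset (Finset (Fin k)) // MaxIntersectingFam 𝒜} → Finset (Fin k),
      ∀ 𝒜 ℬ, 𝒜 ≠ ℬ → g 𝒜 ℬ ∈ 𝒜.1 ∧ g ℬ 𝒜 = (g 𝒜 ℬ)ᶜ := by
  classical
  have hex : ∀ 𝒜 ℬ : {𝒜 : Finset (Finset (Fin k)) // MaxIntersectingFam 𝒜},
      ∃ S, 𝒜 ≠ ℬ → S ∈ 𝒜.1 ∧ Sᶜ ∈ ℬ.1 := by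
    intro 𝒜 ℬ
    by_cases hne : 𝒜 = ℬ
    · exact ⟨∅, fun h ↦ absurd hne h⟩
    · obtain ⟨S, hS⟩ := 𝒜.2.exists_mem_compl_mem ℬ.2 fun h ↦ hne (Subtype.ext h)
      exact ⟨S, fun _ ↦ hS⟩
  choose f hf using hex
  refine ⟨fun 𝒜 ℬ ↦ if WellOrderingRel 𝒜 ℬ then f 𝒜 ℬ else (f ℬ 𝒜)ᶜ, fun 𝒜 ℬ hne ↦ ?_⟩
  rcases trichotomous_of WellOrderingRel 𝒜 ℬ with hlt | heq | hlt
  · have hnot : ¬ WellOrderingRel ℬ 𝒜 := asymm_of WellOrderingRel hlt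
    simp [hlt, hnot, (hf 𝒜 ℬ hne).1]
  · exact absurd heq hne
  · have hnot : ¬ WellOrderingRel 𝒜 ℬ := asymm_of WellOrderingRel hlt
    simp [hlt, hnot, (hf ℬ 𝒜 hne.symm).2]

/-- A graph has an orientation covering by `k` orientations if and only if it can be properly
coloured with the maximal intersecting families on `[k]`. -/
lemma exists_isOrientationCovering_iff_colorable {V : Type*} (G : SimpleGraph V) (k : ℕ) :
    (∃ o : Fin k → V → V → Prop, IsOrientationCovering G o) ↔ G.Colorable (lambdaMI k) := by
  classical
  have hcard : lambdaMI k =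
      Fintype.card {𝒜 : Finset (Finset (Fin k)) // MaxIntersectingFam 𝒜} :=
    Nat.card_eq_fintype_card
  constructor
  · rintro ⟨o, ho, hcov⟩
    have hex : ∀ x, ∃ ℬ : Finset (Finset (Fin k)), MaxIntersectingFam ℬ ∧
        ∀ y, G.Adj x y → Finset.univ.filter (fun i ↦ o i x y) ∈ ℬ := by
      intro x
      have hint : IntersectingFam (Finset.univ.filter fun S : Finset (Fin k) ↦
          ∃ y, G.Adj x y ∧ S = Finset.univ.filter fun i ↦ o i x y) := by
        intro S hS T hT
        obtain ⟨y, hy, rfl⟩ := (Finset.mem_filter.1 hS).2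
        obtain ⟨z, hz, rfl⟩ := (Finset.mem_filter.1 hT).2
        obtain ⟨i, hi⟩ := hcov x y z hy hz
        exact ⟨i, by simpa using hi⟩
      obtain ⟨ℬ, hsub, hℬ⟩ := hint.exists_maxIntersectingFam
      exact ⟨ℬ, hℬ, fun y hy ↦ hsub (Finset.mem_filter.2 ⟨Finset.mem_univ _, y, hy, rfl⟩)⟩
    choose c hc hmem using hex
    rw [hcard]
    refine (Coloring.mk (fun x ↦ ⟨c x, hc x⟩) fun {x y} hxy heq ↦ ?_).colorable
    have hyx := hmem y x hxy.symm
    rw [← Subtype.mk.inj heq] at hyx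
    obtain ⟨i, hi⟩ := (hc x).1 _ (hmem x y hxy) _ hyx
    simp only [Finset.mem_inter, Finset.mem_filter, Finset.mem_univ, true_and] at hi
    exact ((ho i).2 x y hxy).1 hi.1 hi.2
  · intro hcol
    let c : G.Coloring {𝒜 : Finset (Finset (Fin k)) // MaxIntersectingFam 𝒜} :=
      hcol.toColoring hcard.le
    obtain ⟨g, hg⟩ := exists_complementary_choice k
    refine ⟨fun i x y ↦ G.Adj x y ∧ i ∈ g (c x) (c y),
      fun i ↦ ⟨fun _ _ hxy ↦ hxy.1, fun x y hxy ↦ ?_⟩, fun x y z hxy hxz ↦ ?_⟩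
    · simp [hxy, hxy.symm, (hg _ _ (c.valid hxy)).2]
    · obtain ⟨i, hi⟩ := (c x).2.1 _ (hg _ _ (c.valid hxy)).1 _ (hg _ _ (c.valid hxz)).1
      rw [Finset.mem_inter] at hi
      exact ⟨i, ⟨hxy, hi.1⟩, hxz, hi.2⟩

/-- If two finite graphs with at least one edge have the same chromatic number, then
they have the same orientation covering number. -/
theorem orCov_eq_of_chromaticNumber_eq
    {V W : Type*} [Fintype V] [Fintype W]
    (G : SimpleGraph V) (H : SimpleGraph W)
    (hG : ∃ u v, G.Adj u v) (hH : ∃ u v, H.Adj u v)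
    (h : G.chromaticNumber = H.chromaticNumber) :
    orCov G = orCov H := by
  simp only [orCov, exists_isOrientationCovering_iff_colorable,
    ← chromaticNumber_le_iff_colorable, h]
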